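/- arXiv:1011.4216 — 2 statements merged into one kernel-verified Lean document; each statement's English description precedes it below -/
import Mathlib

section
/- Let T be a set-homogeneous tournament (finite or infinite). Then T is k-homogeneous for every k with 1 ≤ k ≤ 4. -/
/-- An a-digraph structure: a binary arc relation on the vertex type. -/
structure ADigraph (V : Type*) where
  arc : V → V → Prop

namespace ADigraph

variable {V W : Type*}

/-- The a-digraph axioms: the arc relation is irreflexive and antisymmetric
(no loops, and never arcs in both directions between two vertices). -/
def IsA (M : ADigraph V) : Prop :=
  (∀ v, ¬ M.arc v v) ∧ ∀ u v, M.arc u v → ¬ M.arc v u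

/-- Isomorphism of a-digraphs. -/
def Iso (M : ADigraph V) (N : ADigraph W) : Prop :=
  ∃ e : V ≃ W, ∀ u v, M.arc u v ↔ N.arc (e u) (e v)

/-- Induced subdigraph on a set of vertices. -/
def induce (M : ADigraph V) (S : Set V) : ADigraph S :=
  ⟨fun u v => M.arc (u : V) (v : V)⟩

/-- `g` is an automorphism of `M`. -/
def IsAuto (M : ADigraph V) (g : V ≃ V) : Prop :=
  ∀ u v, M.arc u v ↔ M.arc (g u) (g v)

/-- `M` is set-homogeneous: whenever two finite sets of vertices induce
isomorphic subdigraphs, some automorphism maps one set onto the other. -/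
def SetHomogeneous (M : ADigraph V) : Prop :=
  ∀ U U' : Set V, U.Finite → U'.Finite → (M.induce U).Iso (M.induce U') →
    ∃ g : V ≃ V, M.IsAuto g ∧ ⇑g '' U = U'

/-- `M` is homogeneous: every isomorphism between finite induced subdigraphs
extends to an automorphism. -/
def Homogeneous (M : ADigraph V) : Prop :=
  ∀ U U' : Set V, U.Finite → U'.Finite → ∀ e : U ≃ U',
    (∀ u v : U, M.arc (u : V) (v : V) ↔ M.arc (e u : V) (e v : V)) →
    ∃ g : V ≃ V, M.IsAuto g ∧ ∀ u : U, g (u : V) = (e u : V)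

/-- `M` is `k`-homogeneous: every isomorphism between induced subdigraphs of
size `k` extends to an automorphism. -/
def KHomogeneous (M : ADigraph V) (k : ℕ) : Prop :=
  ∀ U U' : Set V, U.Finite → U'.Finite → U.ncard = k → U'.ncard = k →
    ∀ e : U ≃ U',
      (∀ u v : U, M.arc (u : V) (v : V) ↔ M.arc (e u : V) (e v : V)) →
      ∃ g : V ≃ V, M.IsAuto g ∧ ∀ u : U, g (u : V) = (e u : V)

/-- The directed `n`-cycle `D_n`: vertices `ZMod n`, arcs `i → i + 1`.
(For `n = 1` this is a single vertex with no arcs.) -/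
def dirCycle (n : ℕ) : ADigraph (ZMod n) :=
  ⟨fun i j => j = i + 1 ∧ i ≠ j⟩

/-- `K̄_n`: the a-digraph on `n` vertices with no arcs. -/
def kbar (n : ℕ) : ADigraph (Fin n) :=
  ⟨fun _ _ => False⟩

/-- The a-digraph with no arcs on an arbitrary vertex type. -/
def kbarOn (N : Type*) : ADigraph N :=
  ⟨fun _ _ => False⟩

/-- The compositional product `M[N]`. -/
def comp (M : ADigraph V) (N : ADigraph W) : ADigraph (V × W) :=
  ⟨fun p q => M.arc p.1 q.1 ∨ (p.1 = q.1 ∧ N.arc p.2 q.2)⟩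

/-- `M` is connected: any two vertices are joined by a path of arcs,
ignoring orientation. -/
def Connected (M : ADigraph V) : Prop :=
  ∀ u v : V, Relation.ReflTransGen (fun a b => M.arc a b ∨ M.arc b a) u v

/-- `H₀`: vertices the 8 nonzero vectors of `GF(3)²`, with an arc `u → v` iff
the determinant of the `2 × 2` matrix with columns `u`, `v` equals `1`. -/
def H0 : ADigraph {v : Fin 2 → ZMod 3 // v ≠ 0} :=
  ⟨fun u v => u.1 0 * v.1 1 - u.1 1 * v.1 0 = 1⟩

end ADigraph

open ADigraph

namespace ADigraph

variable {V : Type*} {M : ADigraph V}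

/-- The group of automorphisms of an a-digraph. -/
def autGroup (M : ADigraph V) : Subgroup (Equiv.Perm V) where
  carrier := {g | M.IsAuto g}
  mul_mem' {g h} hg hh u v := (hh u v).trans (hg (h u) (h v))
  one_mem' _ _ := Iff.rfl
  inv_mem' {g} hg u v := by
    simpa using (hg (g⁻¹ u) (g⁻¹ v)).symm

/-- The group `G` acts set-homogeneously on the vertices in `S`: if two tuples of distinct vertices
of `S` have the same arc pattern, then some element of `G` maps the first into the second, as a
set. -/
def SetTransitiveOn (M : ADigraph V) (G : Subgroup (Equiv.Perm V)) (S : Set V) : Prop :=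
  ∀ (n : ℕ) (f f' : Fin n → V), Function.Injective f → Function.Injective f' →
    (∀ i, f i ∈ S) → (∀ i, f' i ∈ S) →
    (∀ i j, M.arc (f i) (f j) ↔ M.arc (f' i) (f' j)) →
    ∃ g ∈ G, ∀ i, ∃ j, g (f i) = f' j

theorem SetHomogeneous.setTransitiveOn_autGroup (h : M.SetHomogeneous) :
    M.SetTransitiveOn M.autGroup Set.univ := by
  intro n f f' hf hf' _ _ hff
  let e := (Equiv.ofInjective f hf).symm.trans (Equiv.ofInjective f' hf')
  obtain ⟨g, hg, hgU⟩ := h (Set.range f) (Set.range f') (Set.finite_range f)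
    (Set.finite_range f') ⟨e, by
      rintro ⟨_, i, rfl⟩ ⟨_, j, rfl⟩
      simpa [induce, e, Equiv.ofInjective_symm_apply] using hff i j⟩
  refine ⟨g, hg, fun i => ?_⟩
  have : g (f i) ∈ Set.range f' := hgU ▸ ⟨f i, ⟨i, rfl⟩, rfl⟩
  obtain ⟨j, hj⟩ := this
  exact ⟨j, hj.symm⟩

/-- If `d` dominates `S`, or is dominated by it, then the stabilizer of `d` acts set-homogeneously
on `S`. -/
theorem SetHomogeneous.setTransitiveOn_stabilizer (hM : M.IsA) (h : M.SetHomogeneous) {d : V}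
    {S : Set V} (hS : (∀ x ∈ S, M.arc d x) ∨ ∀ x ∈ S, M.arc x d) :
    M.SetTransitiveOn (M.autGroup ⊓ MulAction.stabilizer (Equiv.Perm V) d) S := by
  intro n f f' hf hf' hfS hfS' hff
  have hd : d ∉ S := fun hd => hM.1 d (hS.elim (· d hd) (· d hd))
  have hdf : d ∉ Set.range f := by rintro ⟨i, rfl⟩; exact hd (hfS i)
  have hdf' : d ∉ Set.range f' := by rintro ⟨i, rfl⟩; exact hd (hfS' i)
  obtain ⟨g, hg, hgf⟩ := h.setTransitiveOn_autGroup (n + 1) (Fin.cons d f) (Fin.cons d f')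
    (Fin.cons_injective_iff.2 ⟨hdf, hf⟩) (Fin.cons_injective_iff.2 ⟨hdf', hf'⟩)
    (fun _ => trivial) (fun _ => trivial) (by
      intro i j
      refine Fin.cases ?_ (fun i => ?_) i <;> refine Fin.cases ?_ (fun j => ?_) j
      · simp
      · rcases hS with hS | hS
        · simp [hS _ (hfS j), hS _ (hfS' j)]
        · simp [hM.2 _ _ (hS _ (hfS j)), hM.2 _ _ (hS _ (hfS' j))]
      · rcases hS with hS | hS
        · simp [hM.2 _ _ (hS _ (hfS i)), hM.2 _ _ (hS _ (hfS' i))]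
        · simp [hS _ (hfS i), hS _ (hfS' i)]
      · simpa using hff i j)
  have hcase : ∀ x, (∃ j, x = (Fin.cons d f' : Fin (n + 1) → V) j) → x = d ∨ ∃ j, x = f' j := by
    rintro x ⟨j, hj⟩
    revert hj
    refine Fin.cases (fun hj => Or.inl (by simpa using hj))
      (fun j hj => Or.inr ⟨j, by simpa using hj⟩) j
  have hgd := hcase _ (hgf 0)
  have hgs := fun i : Fin n => hcase _ (hgf i.succ)
  simp only [Fin.cons_zero, Fin.cons_succ] at hgd hgs
  have hfix : g d = d := by
    by_contra hne
    obtain ⟨j, hj⟩ := hgd.resolve_left hne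
    have hhit : ∃ i, g (f i) = d := by
      by_contra! hno
      choose s hs using fun i => (hgs i).resolve_left (hno i)
      have hsinj : Function.Injective s := fun i k hik =>
        hf (g.injective (by rw [hs, hs, hik]))
      obtain ⟨i, rfl⟩ := Finite.surjective_of_injective hsinj j
      exact hdf ⟨i, g.injective (by rw [hs, hj])⟩
    obtain ⟨i, hi⟩ := hhit
    rcases hS with hS | hS
    · have h1 := (hg _ _).1 (hS _ (hfS i))
      rw [hi, hj] at h1
      exact hM.2 _ _ h1 (hS _ (hfS' j))
    · have h1 := (hg _ _).1 (hS _ (hfS i))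
      rw [hi, hj] at h1
      exact hM.2 _ _ h1 (hS _ (hfS' j))
  refine ⟨g, ⟨hg, hfix⟩, fun i => (hgs i).resolve_left fun hi => hdf ⟨i, g.injective ?_⟩⟩
  rw [hi, hfix]

/-- Tuples realising the same rigid pattern are matched pointwise. -/
theorem SetTransitiveOn.exists_map_of_rigid {G : Subgroup (Equiv.Perm V)} {S : Set V}
    (hG : G ≤ M.autGroup) (h : M.SetTransitiveOn G S) {n : ℕ} (p : Fin n → Fin n → Bool)
    (hp : ∀ τ : Fin n → Fin n, (∀ i j, p i j = p (τ i) (τ j)) → τ = id)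
    (f f' : Fin n → V) (hf : Function.Injective f) (hf' : Function.Injective f')
    (hfS : ∀ i, f i ∈ S) (hfS' : ∀ i, f' i ∈ S)
    (hfp : ∀ i j, M.arc (f i) (f j) ↔ p i j) (hfp' : ∀ i j, M.arc (f' i) (f' j) ↔ p i j) :
    ∃ g ∈ G, ∀ i, g (f i) = f' i := by
  obtain ⟨g, hg, hgf⟩ := h n f f' hf hf' hfS hfS' fun i j => (hfp i j).trans (hfp' i j).symm
  choose τ hτ using hgf
  have : τ = id := hp τ fun i j => by
    rw [Bool.eq_iff_iff, ← hfp, ← hfp', ← hτ, ← hτ]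
    exact hG hg _ _
  refine ⟨g, hg, fun i => ?_⟩
  rw [hτ, this, id]

theorem SetTransitiveOn.exists_map_arc (hM : M.IsA) {G : Subgroup (Equiv.Perm V)} {S : Set V}
    (hG : G ≤ M.autGroup) (h : M.SetTransitiveOn G S) {a b a' b' : V}
    (ha : a ∈ S) (hb : b ∈ S) (ha' : a' ∈ S) (hb' : b' ∈ S)
    (hab : M.arc a b) (hab' : M.arc a' b') : ∃ g ∈ G, g a = a' ∧ g b = b' := by
  have hirr := hM.1
  have key : ∀ x y, M.arc x y → Function.Injective ![x, y] ∧
      ∀ i j, M.arc (![x, y] i) (![x, y] j) ↔ (![![false, true], ![false, false]] i j : Bool) := by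
    intro x y hxy
    have hne : x ≠ y := by rintro rfl; exact hirr _ hxy
    refine ⟨?_, ?_⟩
    · intro i j; fin_cases i <;> fin_cases j <;> simp [hne, hne.symm]
    · intro i j; fin_cases i <;> fin_cases j <;> simp [hirr, hxy, hM.2 _ _ hxy]
  obtain ⟨g, hg, hgf⟩ := h.exists_map_of_rigid hG _ (by decide) ![a, b] ![a', b'] (key _ _ hab).1
    (key _ _ hab').1 (by simp [Fin.forall_fin_two, ha, hb]) (by simp [Fin.forall_fin_two, ha', hb'])
    (key _ _ hab).2 (key _ _ hab').2
  exact ⟨g, hg, hgf 0, hgf 1⟩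

/-- The arc pattern of the strongly connected tournament on four vertices. -/
def strongPattern : Fin 4 → Fin 4 → Bool :=
  ![![false, true, false, false], ![false, false, true, true],
    ![true, false, false, true], ![true, false, false, false]]

theorem strongPattern_rigid (τ : Fin 4 → Fin 4)
    (hτ : ∀ i j, strongPattern i j = strongPattern (τ i) (τ j)) : τ = id := by
  have key : ∀ t₀ t₁ t₂ t₃ : Fin 4, t₀ = 0 ∧ t₁ = 1 ∧ t₂ = 2 ∧ t₃ = 3 ∨
      false ∈ [strongPattern t₀ t₁, strongPattern t₁ t₂, strongPattern t₂ t₀,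
        strongPattern t₁ t₃, strongPattern t₃ t₀, strongPattern t₂ t₃] := by
    decide
  have := key (τ 0) (τ 1) (τ 2) (τ 3)
  simp only [← hτ] at this
  obtain ⟨h0, h1, h2, h3⟩ := this.resolve_right (by decide)
  funext i
  fin_cases i <;> assumption

/-- Two arcs inside the common completion set of an arc `a → b` to a directed triangle are matched
by an element fixing `a` and `b`. -/
theorem SetTransitiveOn.exists_map_triangle_completions (hM : M.IsA)
    {G : Subgroup (Equiv.Perm V)} {S : Set V}
    (hG : G ≤ M.autGroup) (h : M.SetTransitiveOn G S) {a b c d c' d' : V}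
    (ha : a ∈ S) (hb : b ∈ S) (hc : c ∈ S) (hd : d ∈ S) (hc' : c' ∈ S) (hd' : d' ∈ S)
    (hab : M.arc a b) (hbc : M.arc b c) (hca : M.arc c a) (hbd : M.arc b d) (hda : M.arc d a)
    (hbc' : M.arc b c') (hca' : M.arc c' a) (hbd' : M.arc b d') (hda' : M.arc d' a)
    (hcd : M.arc c d) (hcd' : M.arc c' d') :
    ∃ g ∈ G, g a = a ∧ g b = b ∧ g c = c' ∧ g d = d' := by
  have hirr := hM.1
  have key : ∀ x y, M.arc b x → M.arc x a → M.arc b y → M.arc y a → M.arc x y →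
      Function.Injective ![a, b, x, y] ∧
      ∀ i j, M.arc (![a, b, x, y] i) (![a, b, x, y] j) ↔
        strongPattern i j := by
    intro x y hbx hxa hby hya hxy
    have hne : ∀ {u v}, M.arc u v → u ≠ v := by rintro u _ huv rfl; exact hirr _ huv
    refine ⟨?_, ?_⟩
    · intro i j
      fin_cases i <;> fin_cases j <;>
        simp [hne hab, hne hbx, hne hxa, hne hby, hne hya, hne hxy, (hne hab).symm,
          (hne hbx).symm, (hne hxa).symm, (hne hby).symm, (hne hya).symm, (hne hxy).symm]
    · intro i j
      fin_cases i <;> fin_cases j <;>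
        simp [strongPattern, hirr, hab, hbx, hxa, hby, hya, hxy, hM.2 _ _ hab, hM.2 _ _ hbx,
          hM.2 _ _ hxa, hM.2 _ _ hby, hM.2 _ _ hya, hM.2 _ _ hxy]
  have k := key _ _ hbc hca hbd hda hcd
  have k' := key _ _ hbc' hca' hbd' hda' hcd'
  obtain ⟨g, hg, hgf⟩ := h.exists_map_of_rigid hG _ strongPattern_rigid ![a, b, c, d]
    ![a, b, c', d']
    k.1 k'.1 (by intro i; fin_cases i <;> simpa) (by intro i; fin_cases i <;> simpa) k.2 k'.2
  exact ⟨g, hg, hgf 0, hgf 1, hgf 2, hgf 3⟩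

/-- A directed triangle in `S` is rotated by an element of `G`. -/
theorem SetTransitiveOn.exists_rotation (hM : M.IsA)
    (htour : ∀ u v : V, u ≠ v → M.arc u v ∨ M.arc v u)
    {G : Subgroup (Equiv.Perm V)} {S : Set V} (hG : G ≤ M.autGroup)
    (hGS : ∀ g ∈ G, ∀ x ∈ S, g x ∈ S) (h : M.SetTransitiveOn G S) {a b c : V}
    (ha : a ∈ S) (hb : b ∈ S) (hc : c ∈ S)
    (hab : M.arc a b) (hbc : M.arc b c) (hca : M.arc c a) :
    ∃ g ∈ G, g a = b ∧ g b = c ∧ g c = a := by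
  obtain ⟨g₁, hg₁, hb₁, hc₁⟩ := h.exists_map_arc hM hG hb hc ha hb hbc hab
  obtain ⟨g₂, hg₂, hc₂, ha₂⟩ := h.exists_map_arc hM hG hc ha ha hb hca hab
  have hbx : M.arc b (g₁ a) := hc₁ ▸ (hG hg₁ _ _).1 hca
  have hxa : M.arc (g₁ a) a := by simpa only [hb₁] using (hG hg₁ _ _).1 hab
  have hby : M.arc b (g₂ b) := by simpa only [ha₂] using (hG hg₂ _ _).1 hab
  have hya : M.arc (g₂ b) a := by simpa only [hc₂] using (hG hg₂ _ _).1 hbc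
  have hx := hGS g₁ hg₁ a ha
  have hy := hGS g₂ hg₂ b hb
  have rot₁ : ∀ k ∈ G, k a = a → k b = b → k c = g₁ a → ∃ g ∈ G, g a = b ∧ g b = c ∧ g c = a := by
    intro k hk h1 h2 h3
    exact ⟨g₁⁻¹ * k, mul_mem (inv_mem hg₁) hk,
      by simp [h1, Equiv.symm_apply_eq, hb₁], by simp [h2, Equiv.symm_apply_eq, hc₁],
      by simp [h3]⟩
  have rot₂ : ∀ k ∈ G, k a = a → k b = b → k c = g₂ b → ∃ g ∈ G, g a = b ∧ g b = c ∧ g c = a := by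
    intro k hk h1 h2 h3
    refine ⟨k⁻¹ * g₂, mul_mem (inv_mem hk) hg₂, ?_, ?_, ?_⟩ <;>
      simp [Equiv.symm_apply_eq, *]
  have rot₃ : ∀ k ∈ G, k a = a → k b = b → k (g₁ a) = g₂ b →
      ∃ g ∈ G, g a = b ∧ g b = c ∧ g c = a := by
    intro k hk h1 h2 h3
    refine ⟨g₂⁻¹ * (k * g₁), mul_mem (inv_mem hg₂) (mul_mem hk hg₁), ?_, ?_, ?_⟩ <;>
      simp [Equiv.symm_apply_eq, *]
  by_cases hcx : c = g₁ a
  · exact rot₁ 1 (one_mem _) rfl rfl hcx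
  by_cases hcy : c = g₂ b
  · exact rot₂ 1 (one_mem _) rfl rfl hcy
  rcases htour _ _ hcx with h1 | h1 <;> rcases htour _ _ hcy with h2 | h2
  · obtain ⟨k, hk, hka, hkb, -, hkx⟩ := h.exists_map_triangle_completions hM hG ha hb hc hx hc hy
      hab hbc hca hbx hxa hbc hca hby hya h1 h2
    exact rot₃ k hk hka hkb hkx
  · obtain ⟨k, hk, hka, hkb, hkc, -⟩ := h.exists_map_triangle_completions hM hG ha hb hc hx hy hc
      hab hbc hca hbx hxa hby hya hbc hca h1 h2
    exact rot₂ k hk hka hkb hkc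
  · obtain ⟨k, hk, hka, hkb, hkc, -⟩ := h.exists_map_triangle_completions hM hG ha hb hc hy hx hc
      hab hbc hca hby hya hbx hxa hbc hca h2 h1
    exact rot₁ k hk hka hkb hkc
  · obtain ⟨k, hk, hka, hkb, hkx, -⟩ := h.exists_map_triangle_completions hM hG ha hb hx hc hy hc
      hab hbx hxa hbc hca hby hya hbc hca h1 h2
    exact rot₃ k hk hka hkb hkx

/-- A permutation of at most four points without transpositions among its cycles is trivial or a
three-cycle. -/
theorem perm_fin_eq_one_or_three_cycle {k : ℕ} (hk : k ≤ 4) (σ : Equiv.Perm (Fin k))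
    (hσ : ∀ i, σ (σ i) = i → σ i = i) (h4 : ∀ i, σ (σ (σ (σ i))) = i → σ (σ i) = i) :
    σ = 1 ∨ ∃ i, σ i ≠ i ∧ σ (σ (σ i)) = i ∧
      ∀ j, j = i ∨ j = σ i ∨ j = σ (σ i) ∨
        (σ j = j ∧ ∀ l, l = i ∨ l = σ i ∨ l = σ (σ i) ∨ l = j) := by
  interval_cases k <;> revert σ <;> decide

/-- An automorphism of an induced tournament on at most four vertices of a set-homogeneous
tournament extends to the whole tournament. -/
theorem exists_autGroup_of_perm (hM : M.IsA)
    (htour : ∀ u v : V, u ≠ v → M.arc u v ∨ M.arc v u) (hsh : M.SetHomogeneous) {k : ℕ}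
    (hk : k ≤ 4) (f : Fin k → V) (hf : Function.Injective f) (σ : Equiv.Perm (Fin k))
    (hσ : ∀ i j, M.arc (f i) (f j) ↔ M.arc (f (σ i)) (f (σ j))) :
    ∃ h ∈ M.autGroup, ∀ i, h (f i) = f (σ i) := by
  have hswap : ∀ i j, M.arc (f i) (f j) → M.arc (f j) (f i) → False :=
    fun i j hij hji => hM.2 _ _ hij hji
  have hinv : ∀ i, σ (σ i) = i → σ i = i := by
    intro i hi
    by_contra hne
    have := hσ i (σ i)
    rw [hi] at this
    rcases htour _ _ (hf.ne hne) with h | h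
    · exact hswap _ _ h (this.2 h)
    · exact hswap _ _ h (this.1 h)
  have hinv₄ : ∀ i, σ (σ (σ (σ i))) = i → σ (σ i) = i := by
    intro i hi
    by_contra hne
    have := (hσ i (σ (σ i))).trans (hσ (σ i) (σ (σ (σ i))))
    rw [hi] at this
    rcases htour _ _ (hf.ne hne) with h | h
    · exact hswap _ _ h (this.2 h)
    · exact hswap _ _ h (this.1 h)
  rcases perm_fin_eq_one_or_three_cycle hk σ hinv hinv₄ with rfl | ⟨i, hne, hi, hall⟩
  · exact ⟨1, one_mem _, fun _ => rfl⟩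
  have rot : ∀ {G : Subgroup (Equiv.Perm V)} {S : Set V}, G ≤ M.autGroup →
      (∀ g ∈ G, ∀ x ∈ S, g x ∈ S) → M.SetTransitiveOn G S →
      f i ∈ S → f (σ i) ∈ S → f (σ (σ i)) ∈ S →
      ∃ g ∈ G, g (f i) = f (σ i) ∧ g (f (σ i)) = f (σ (σ i)) ∧ g (f (σ (σ i))) = f i := by
    intro G S hG hGS hS h0 h1 h2
    have e1 := hσ i (σ i)
    have e2 := hσ (σ i) (σ (σ i))
    have e1' := hσ (σ i) i
    have e2' := hσ (σ (σ i)) (σ i)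
    rw [hi] at e2 e2'
    rcases htour _ _ (hf.ne hne) with h | h
    · obtain ⟨g, hg, ga, gb, gc⟩ := hS.exists_rotation hM htour hG hGS h0 h2 h1
        (e2'.1 (e1'.1 h)) (e1'.1 h) h
      refine ⟨g⁻¹, inv_mem hg, ?_, ?_, ?_⟩ <;> simp [Equiv.symm_apply_eq, ga, gb, gc]
    · exact hS.exists_rotation hM htour hG hGS h0 h1 h2 h (e1.1 h) (e2.1 (e1.1 h))
  by_cases hd : ∃ d, d ≠ i ∧ d ≠ σ i ∧ d ≠ σ (σ i)
  · obtain ⟨d, hd0, hd1, hd2⟩ := hd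
    obtain ⟨hσd, hl⟩ := (((hall d).resolve_left hd0).resolve_left hd1).resolve_left hd2
    have hout : ∀ l, M.arc (f d) (f l) ↔ M.arc (f d) (f (σ l)) := fun l => by
      simpa only [hσd] using hσ d l
    have hin : ∀ l, M.arc (f l) (f d) ↔ M.arc (f (σ l)) (f d) := fun l => by
      simpa only [hσd] using hσ l d
    have extend :
        (∃ g ∈ M.autGroup ⊓ MulAction.stabilizer (Equiv.Perm V) (f d),
          g (f i) = f (σ i) ∧ g (f (σ i)) = f (σ (σ i)) ∧ g (f (σ (σ i))) = f i) →
        ∃ h ∈ M.autGroup, ∀ i, h (f i) = f (σ i) := by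
      rintro ⟨g, ⟨hg, hgd⟩, g0, g1, g2⟩
      refine ⟨g, hg, fun j => ?_⟩
      rcases hl j with rfl | rfl | rfl | rfl
      · exact g0
      · exact g1
      · rw [g2, hi]
      · rw [hσd]; exact hgd
    rcases htour _ _ (hf.ne hd0) with h | h
    · refine extend (rot (S := {x | M.arc (f d) x}) inf_le_left ?_
        (hsh.setTransitiveOn_stabilizer hM (Or.inl fun _ hx => hx)) h ((hout _).1 h)
        ((hout _).1 ((hout _).1 h)))
      rintro g ⟨hg, hgd⟩ x hx
      have := (hg _ _).1 hx
      rwa [show g (f d) = f d from hgd] at this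
    · refine extend (rot (S := {x | M.arc x (f d)}) inf_le_left ?_
        (hsh.setTransitiveOn_stabilizer hM (Or.inr fun _ hx => hx)) h ((hin _).1 h)
        ((hin _).1 ((hin _).1 h)))
      rintro g ⟨hg, hgd⟩ x hx
      have := (hg _ _).1 hx
      rwa [show g (f d) = f d from hgd] at this
  · obtain ⟨g, hg, g0, g1, g2⟩ := rot (S := Set.univ) le_rfl (fun _ _ _ _ => trivial)
      hsh.setTransitiveOn_autGroup trivial trivial trivial
    refine ⟨g, hg, fun j => ?_⟩
    by_cases j0 : j = i
    · rw [j0, g0]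
    by_cases j1 : j = σ i
    · rw [j1, g1]
    by_cases j2 : j = σ (σ i)
    · rw [j2, g2, hi]
    exact absurd ⟨j, j0, j1, j2⟩ hd

end ADigraph

/-- Every set-homogeneous tournament (finite or infinite)
is `k`-homogeneous for every `k` with `1 ≤ k ≤ 4`. -/
theorem set_homogeneous_tournament_four_homogeneous
    {V : Type} (M : ADigraph V) (hM : M.IsA)
    (htour : ∀ u v : V, u ≠ v → M.arc u v ∨ M.arc v u)
    (hsh : M.SetHomogeneous) :
    ∀ k : ℕ, 1 ≤ k → k ≤ 4 → M.KHomogeneous k := by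
  intro k _ hk U U' hU hU' hUk hUk' e he
  classical
  have := hU.to_subtype
  let fU : Fin k ≃ U := (Finite.equivFinOfCardEq (hUk ▸ Nat.card_coe_set_eq U)).symm
  let f : Fin k → V := fun i => fU i
  let f' : Fin k → V := fun i => e (fU i)
  have hf : Function.Injective f := Subtype.val_injective.comp fU.injective
  have hf' : Function.Injective f' := Subtype.val_injective.comp (e.injective.comp fU.injective)
  have hff : ∀ i j, M.arc (f i) (f j) ↔ M.arc (f' i) (f' j) := fun i j => he _ _
  obtain ⟨g, hg, hgf⟩ := hsh.setTransitiveOn_autGroup k f f' hf hf' (fun _ => trivial)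
    (fun _ => trivial) hff
  choose τ hτ using hgf
  have hτi : Function.Injective τ := fun i j hij =>
    hf (g.injective (by rw [hτ, hτ, hij]))
  let σ : Equiv.Perm (Fin k) := Equiv.ofBijective τ hτi.bijective_of_finite
  have hσ : ∀ i, g (f i) = f' (σ i) := hτ
  have hσa : ∀ i j, M.arc (f i) (f j) ↔ M.arc (f (σ i)) (f (σ j)) := fun i j => by
    rw [hff (σ i), ← hσ, ← hσ]
    exact hg _ _
  obtain ⟨h, hh, hhf⟩ := exists_autGroup_of_perm hM htour hsh hk f hf σ hσa
  refine ⟨g * h⁻¹, mul_mem (S := Subgroup (Equiv.Perm V)) hg (inv_mem hh), fun u => ?_⟩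
  obtain ⟨i, rfl⟩ := fU.surjective u
  have hi : h (f (σ⁻¹ i)) = f i := by rw [hhf]; simp
  have : h⁻¹ (f i) = f (σ⁻¹ i) := by rw [Equiv.Perm.inv_eq_iff_eq, hi]
  change g (h⁻¹ (f i)) = f' i
  rw [this, hσ]
  simp
end

section
/- Let M be a countably infinite homogeneous relational structure which is locally rigid. Then every set-homogeneous subgroup of Aut(M) is dense in Aut(M); that is, for every finite subset A of M and every f ∈ Aut(M), there is g ∈ G agreeing with f on A. -/
/-- A relational structure on `V`: an indexed family of finitary relations
on `V` (the interpretations of the symbols of a relational first-order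
language). -/
structure RelStructure (V : Type) where
  ι : Type
  arity : ι → ℕ
  rel : ∀ i : ι, (Fin (arity i) → V) → Prop

namespace RelStructure

variable {V : Type}

/-- `g` is an automorphism of `M`. -/
def IsAuto (M : RelStructure V) (g : V ≃ V) : Prop :=
  ∀ (i : M.ι) (x : Fin (M.arity i) → V),
    M.rel i x ↔ M.rel i fun k => g (x k)

/-- `e` is an isomorphism between the substructures induced on `U` and `U'`. -/
def IsoOn (M : RelStructure V) (U U' : Set V) (e : U ≃ U') : Prop :=
  ∀ (i : M.ι) (x : Fin (M.arity i) → U),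
    (M.rel i fun k => (x k : V)) ↔ M.rel i fun k => (e (x k) : V)

/-- `M` is homogeneous: every isomorphism between finite induced
substructures extends to an automorphism. -/
def Homogeneous (M : RelStructure V) : Prop :=
  ∀ U U' : Set V, U.Finite → U'.Finite → ∀ e : U ≃ U', M.IsoOn U U' e →
    ∃ g : V ≃ V, M.IsAuto g ∧ ∀ u : U, g (u : V) = (e u : V)

/-- `M` is locally rigid: every finite substructure `U` is contained in a
finite substructure `W` all of whose automorphisms fix `U` pointwise. -/
def LocallyRigid (M : RelStructure V) : Prop :=
  ∀ U : Set V, U.Finite → ∃ W : Set V, W.Finite ∧ U ⊆ W ∧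
    ∀ h : W ≃ W, M.IsoOn W W h → ∀ x : W, (x : V) ∈ U → (h x : V) = (x : V)

/-- The subgroup `G` of the automorphism group of `M` acts
set-homogeneously: its elements are automorphisms, and any two isomorphic
finite induced substructures are mapped onto one another by some element
of `G`. -/
def SetHomogeneousSubgroup (M : RelStructure V)
    (G : Subgroup (Equiv.Perm V)) : Prop :=
  (∀ g ∈ G, M.IsAuto g) ∧
    ∀ U U' : Set V, U.Finite → U'.Finite →
      (∃ e : U ≃ U', M.IsoOn U U' e) →
      ∃ g ∈ G, ⇑g '' U = U'

end RelStructure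

namespace RelStructure

variable {V : Type} {M : RelStructure V}

/-- An automorphism restricts to an isomorphism from a set onto its image. -/
theorem IsAuto.isoOn_image {f : V ≃ V} (hf : M.IsAuto f) (U : Set V) :
    M.IsoOn U (f '' U) (f.image U) :=
  fun i x => hf i fun k => (x k : V)

theorem IsAuto.symm {f : V ≃ V} (hf : M.IsAuto f) : M.IsAuto f.symm :=
  fun i x => by simpa using (hf i fun k => f.symm (x k)).symm

theorem IsAuto.trans {f g : V ≃ V} (hf : M.IsAuto f) (hg : M.IsAuto g) :
    M.IsAuto (f.trans g) :=
  fun i x => (hf i x).trans (hg i fun k => f (x k))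

end RelStructure

/-- If `M` is a countably infinite homogeneous relational
structure which is locally rigid, then every set-homogeneous subgroup `G` of
`Aut(M)` is dense in `Aut(M)`: for every finite subset `A` of `M` and every
automorphism `f` there is `g ∈ G` agreeing with `f` on `A`. -/
theorem locally_rigid_set_homogeneous_subgroup_dense
    {V : Type} [Countable V] [Infinite V] (M : RelStructure V)
    (hhom : M.Homogeneous) (hrigid : M.LocallyRigid)
    (G : Subgroup (Equiv.Perm V)) (hG : M.SetHomogeneousSubgroup G) :
    ∀ A : Set V, A.Finite → ∀ f : V ≃ V, M.IsAuto f →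
      ∃ g ∈ G, ∀ a ∈ A, g a = f a := by
  intro A hA f hf
  obtain ⟨W, hW, hAW, hfix⟩ := hrigid A hA
  obtain ⟨g, hgG, hg⟩ := hG.2 W (f '' W) hW (hW.image f) ⟨_, hf.isoOn_image W⟩
  have hmem : ∀ v, v ∈ W ↔ g.trans f.symm v ∈ W := fun v => by
    rw [← g.injective.mem_set_image, hg, Equiv.trans_apply, f.image_eq_preimage_symm,
      Set.mem_preimage]
  refine ⟨g, hgG, fun a ha => ?_⟩
  have h := hfix ((g.trans f.symm).subtypeEquiv hmem)
    (fun i x => ((hG.1 g hgG).trans hf.symm) i fun k => (x k : V)) ⟨a, hAW ha⟩ ha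
  exact f.symm_apply_eq.mp h
end
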